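/- arXiv:2511.17157 — 2 statements merged into one kernel-verified Lean document; each statement's English description precedes it below -/
import Mathlib

section
/- Consider min_{x ∈ ℝⁿ} F(x) = f(x) + g(x) with f : ℝⁿ → ℝ convex differentiable satisfying f(x') ≤ f(x) + ⟨∇f(x), x' − x⟩ + (L/2)‖x' − x‖² for all x, x' (L ≥ 0), g : ℝⁿ → ℝ convex, and x* a minimizer of F. Fix γ > 0 with α := L/γ ∈ (0, 1]. Let t₀ = 0 and t_k = (1 + √(1 + 4 t_{k−1}²))/2, θ_k = 1/t_k, τ_k = γ·θ_k for k ≥ 1. Let x¹ = x̂¹ = x_ag¹ ∈ ℝⁿ and for k ≥ 1 define x_md^k = (1 − θ_k)·x_ag^k + θ_k·x̂^k; x^{k+1} a minimizer over ℝⁿ of x ↦ g(x) + (τ_k/2)‖x − (x̂^k − (1/τ_k)∇f(x_md^k))‖²; x̂^{k+1} = (α − 1)·x̂^k + (2 − α)·x^{k+1}; x_ag^{k+1} = (1 − θ_k)·x_ag^k + θ_k·x^{k+1}. Then for every k ≥ 1: t_k²·(F(x_ag^{k+1}) − F(x*)) ≤ (γ/(2(2 − α)))·(‖x̂¹ − x*‖²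 − ‖x̂^{k+1} − x*‖²). -/
open scoped RealInnerProductSpace

section ConvexOptimization

variable {E : Type*} [NormedAddCommGroup E] [InnerProductSpace ℝ E]

/-- First-order characterization of convexity: the tangent plane lies below the graph. -/
theorem ConvexOn.add_inner_le_of_hasGradientAt [CompleteSpace E] {f : E → ℝ} {v x : E}
    (hf : ConvexOn ℝ Set.univ f) (hx : HasGradientAt f v x) (y : E) :
    f x + ⟪v, y - x⟫ ≤ f y := by
  have hconv : ConvexOn ℝ Set.univ (fun s : ℝ => f (AffineMap.lineMap x y s)) :=
    hf.comp_affineMap (AffineMap.lineMap x y)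
  have hderiv : HasDerivAt (fun s : ℝ => f (AffineMap.lineMap x y s)) ⟪v, y - x⟫ 0 := by
    have hx' : HasFDerivAt f (InnerProductSpace.toDual ℝ E v)
        (AffineMap.lineMap x y (0 : ℝ)) := by
      simpa using hx.hasFDerivAt
    exact (hx'.comp_hasDerivAt (0 : ℝ) AffineMap.hasDerivAt_lineMap).congr_deriv (by simp)
  have h := hconv.le_slope_of_hasDerivAt (Set.mem_univ 0) (Set.mem_univ 1) zero_lt_one hderiv
  simp only [slope_def_field, AffineMap.lineMap_apply_one, AffineMap.lineMap_apply_zero, sub_zero,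
    div_one] at h
  linarith

/-- Variational inequality for a minimizer of a convex function plus a quadratic. -/
theorem ConvexOn.le_add_inner_of_isMinOn_add_sq {g : E → ℝ} (hg : ConvexOn ℝ Set.univ g)
    {c p : E} {r : ℝ} (hp : ∀ y, g p + r / 2 * ‖p - c‖ ^ 2 ≤ g y + r / 2 * ‖y - c‖ ^ 2) (y : E) :
    g p ≤ g y + r * ⟪p - c, y - p⟫ := by
  have key : ∀ s ∈ Set.Ioc (0 : ℝ) 1,
      g p ≤ g y + r * ⟪p - c, y - p⟫ + s * (r / 2 * ‖y - p‖ ^ 2) := by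
    intro s hs
    have hmin := hp ((1 - s) • p + s • y)
    have hconv := hg.2 (Set.mem_univ p) (Set.mem_univ y) (sub_nonneg.2 hs.2) hs.1.le (by ring)
    have hnorm : ‖(1 - s) • p + s • y - c‖ ^ 2
        = ‖p - c‖ ^ 2 + 2 * (s * ⟪p - c, y - p⟫) + s ^ 2 * ‖y - p‖ ^ 2 := by
      rw [show (1 - s) • p + s • y - c = (p - c) + s • (y - p) by module, norm_add_sq_real,
        inner_smul_right, norm_smul, mul_pow, Real.norm_eq_abs, sq_abs]
    rw [hnorm] at hmin
    simp only [smul_eq_mul] at hconv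
    refine le_of_mul_le_mul_left ?_ hs.1
    linarith
  have hlim : Filter.Tendsto (fun s : ℝ => g y + r * ⟪p - c, y - p⟫ + s * (r / 2 * ‖y - p‖ ^ 2))
      (nhdsWithin 0 (Set.Ioi 0)) (nhds (g y + r * ⟪p - c, y - p⟫)) := by
    refine tendsto_nhdsWithin_of_tendsto_nhds ?_
    exact Continuous.tendsto' (by fun_prop) _ _ (by simp)
  refine ge_of_tendsto hlim ?_
  filter_upwards [Ioc_mem_nhdsGT (zero_lt_one' ℝ)] with s hs using key s hs

/-- One step of the accelerated proximal gradient method, compared with an arbitrary point `z`. -/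
theorem accelerated_proximal_gradient_step [CompleteSpace E] {f g : E → ℝ} {L γ t : ℝ}
    (hγ : 0 < γ) (hα : L / γ < 2) (ht : 1 ≤ t)
    (hf : ConvexOn ℝ Set.univ f) (hg : ConvexOn ℝ Set.univ g)
    {v xag xhat xmd xnext : E} (hv : HasGradientAt f v xmd)
    (hsmooth : ∀ y, f y ≤ f xmd + ⟪v, y - xmd⟫ + L / 2 * ‖y - xmd‖ ^ 2)
    (hmd : xmd = (1 - 1 / t) • xag + (1 / t) • xhat)
    (hmin : ∀ y, g xnext + γ * (1 / t) / 2 * ‖xnext - (xhat - (1 / (γ * (1 / t))) • v)‖ ^ 2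
      ≤ g y + γ * (1 / t) / 2 * ‖y - (xhat - (1 / (γ * (1 / t))) • v)‖ ^ 2) (z : E) :
    t ^ 2 * (f ((1 - 1 / t) • xag + (1 / t) • xnext) + g ((1 - 1 / t) • xag + (1 / t) • xnext)
        - (f z + g z))
      ≤ (t ^ 2 - t) * (f xag + g xag - (f z + g z))
        + γ / (2 * (2 - L / γ)) * (‖xhat - z‖ ^ 2
          - ‖(L / γ - 1) • xhat + (2 - L / γ) • xnext - z‖ ^ 2) := by
  have ht0 : 0 < t := by linarith
  set θ := 1 / t with hθ
  have htθ : t * θ = 1 := by rw [hθ]; field_simp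
  have hθ0 : 0 < θ := by positivity
  have hθ1 : 0 ≤ 1 - θ := by rw [hθ, sub_nonneg, div_le_one ht0]; exact ht
  have hprox := hg.le_add_inner_of_isMinOn_add_sq hmin z
  have hprox_inner : γ * θ * ⟪xnext - (xhat - (1 / (γ * θ)) • v), z - xnext⟫
      = -(γ * θ * ⟪xnext - xhat, xnext - z⟫) - ⟪v, xnext - z⟫ := by
    rw [show xnext - (xhat - (1 / (γ * θ)) • v) = (xnext - xhat) + (1 / (γ * θ)) • v by module,
      ← neg_sub xnext z, inner_neg_right, inner_add_left, real_inner_smul_left]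
    field_simp
    ring
  rw [hprox_inner] at hprox
  have hg_ag := hg.2 (Set.mem_univ xag) (Set.mem_univ xnext) hθ1 hθ0.le (by ring)
  simp only [smul_eq_mul] at hg_ag
  have hf_ag := mul_le_mul_of_nonneg_left (hf.add_inner_le_of_hasGradientAt hv xag) hθ1
  have hf_z := mul_le_mul_of_nonneg_left (hf.add_inner_le_of_hasGradientAt hv z) hθ0.le
  have hf_next := hsmooth ((1 - θ) • xag + θ • xnext)
  have hinner : ⟪v, (1 - θ) • xag + θ • xnext - xmd⟫
      = (1 - θ) * ⟪v, xag - xmd⟫ + θ * ⟪v, z - xmd⟫ + θ * ⟪v, xnext - z⟫ := by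
    rw [← real_inner_smul_right, ← real_inner_smul_right, ← real_inner_smul_right,
      ← inner_add_right, ← inner_add_right]
    congr 1
    module
  have hnorm : ‖(1 - θ) • xag + θ • xnext - xmd‖ ^ 2 = θ ^ 2 * ‖xnext - xhat‖ ^ 2 := by
    rw [hmd, show (1 - θ) • xag + θ • xnext - ((1 - θ) • xag + θ • xhat)
      = θ • (xnext - xhat) by module, norm_smul, mul_pow, Real.norm_eq_abs, sq_abs]
  have hdescent : f ((1 - θ) • xag + θ • xnext) + g ((1 - θ) • xag + θ • xnext) - (f z + g z)
      ≤ (1 - θ) * (f xag + g xag - (f z + g z))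
        + θ ^ 2 * (L / 2 * ‖xnext - xhat‖ ^ 2 - γ * ⟪xnext - xhat, xnext - z⟫) := by
    rw [hinner, hnorm] at hf_next
    linarith [mul_le_mul_of_nonneg_left hprox hθ0.le]
  have hdist : γ / (2 * (2 - L / γ)) * (‖xhat - z‖ ^ 2
      - ‖(L / γ - 1) • xhat + (2 - L / γ) • xnext - z‖ ^ 2)
      = L / 2 * ‖xnext - xhat‖ ^ 2 - γ * ⟪xnext - xhat, xnext - z⟫ := by
    obtain ⟨α, rfl⟩ : ∃ α, L = α * γ := ⟨L / γ, by field_simp⟩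
    rw [mul_div_cancel_right₀ _ hγ.ne'] at hα ⊢
    have hα' : 2 - α ≠ 0 := by linarith
    rw [show (α - 1) • xhat + (2 - α) • xnext - z
        = (xnext - z) + (1 - α) • (xnext - xhat) by module,
      show xhat - z = (xnext - z) - (xnext - xhat) by module, norm_add_sq_real, norm_sub_sq_real,
      inner_smul_right, norm_smul, mul_pow, Real.norm_eq_abs, sq_abs,
      real_inner_comm (xnext - xhat)]
    field_simp
    ring
  rw [hdist]
  calc _ ≤ t ^ 2 * _ := mul_le_mul_of_nonneg_left hdescent (sq_nonneg t)
    _ = (t ^ 2 - t * (t * θ)) * (f xag + g xag - (f z + g z))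
        + (t * θ) ^ 2 * (L / 2 * ‖xnext - xhat‖ ^ 2 - γ * ⟪xnext - xhat, xnext - z⟫) := by ring
    _ = _ := by rw [htθ]; ring

end ConvexOptimization

theorem gpgm_telescoped_bound {n : ℕ}
    (f g : EuclideanSpace ℝ (Fin n) → ℝ)
    (f' : EuclideanSpace ℝ (Fin n) → EuclideanSpace ℝ (Fin n))
    (L γ : ℝ) (hL : 0 ≤ L) (hγ : 0 < γ) (hα : L / γ ∈ Set.Ioc (0 : ℝ) 1)
    (hdiff : ∀ x, HasGradientAt f (f' x) x)
    (hfconv : ConvexOn ℝ Set.univ f)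
    (hgconv : ConvexOn ℝ Set.univ g)
    (hsmooth : ∀ x x', f x' ≤ f x + ⟪f' x, x' - x⟫ + L / 2 * ‖x' - x‖ ^ 2)
    (xstar : EuclideanSpace ℝ (Fin n))
    (hstar : ∀ x, f xstar + g xstar ≤ f x + g x)
    (t θ τ : ℕ → ℝ)
    (ht0 : t 0 = 0)
    (htrec : ∀ k : ℕ, t (k + 1) = (1 + Real.sqrt (1 + 4 * t k ^ 2)) / 2)
    (hθ : ∀ k : ℕ, 1 ≤ k → θ k = 1 / t k)
    (hτ : ∀ k : ℕ, 1 ≤ k → τ k = γ * θ k)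
    (x xhat xag xmd : ℕ → EuclideanSpace ℝ (Fin n))
    (hinit1 : x 1 = xhat 1) (hinit2 : x 1 = xag 1)
    (hmd : ∀ k : ℕ, 1 ≤ k → xmd k = (1 - θ k) • xag k + θ k • xhat k)
    (hmin : ∀ k : ℕ, 1 ≤ k → ∀ y : EuclideanSpace ℝ (Fin n),
      g (x (k + 1)) + τ k / 2 * ‖x (k + 1) - (xhat k - (1 / τ k) • f' (xmd k))‖ ^ 2
        ≤ g y + τ k / 2 * ‖y - (xhat k - (1 / τ k) • f' (xmd k))‖ ^ 2)
    (hhat : ∀ k : ℕ, 1 ≤ k →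
      xhat (k + 1) = (L / γ - 1) • xhat k + (2 - L / γ) • x (k + 1))
    (hag : ∀ k : ℕ, 1 ≤ k →
      xag (k + 1) = (1 - θ k) • xag k + θ k • x (k + 1)) :
    ∀ k : ℕ, 1 ≤ k →
      t k ^ 2 * ((f (xag (k + 1)) + g (xag (k + 1))) - (f xstar + g xstar))
        ≤ γ / (2 * (2 - L / γ)) * (‖xhat 1 - xstar‖ ^ 2 - ‖xhat (k + 1) - xstar‖ ^ 2) := by
  have ht1 : ∀ k, 1 ≤ t (k + 1) := by
    intro k
    have : 1 ≤ √(1 + 4 * t k ^ 2) := Real.one_le_sqrt.2 (by nlinarith [sq_nonneg (t k)])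
    linarith [htrec k]
  have htsq : ∀ k, t (k + 1) ^ 2 - t (k + 1) = t k ^ 2 := by
    intro k
    have hsq := Real.sq_sqrt (show 0 ≤ 1 + 4 * t k ^ 2 by positivity)
    rw [htrec k]
    linarith
  have hstep : ∀ k,
      t (k + 1) ^ 2 * (f (xag (k + 2)) + g (xag (k + 2)) - (f xstar + g xstar))
        ≤ t k ^ 2 * (f (xag (k + 1)) + g (xag (k + 1)) - (f xstar + g xstar))
          + γ / (2 * (2 - L / γ)) * (‖xhat (k + 1) - xstar‖ ^ 2 - ‖xhat (k + 2) - xstar‖ ^ 2) := by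
    intro k
    have hk : 1 ≤ k + 1 := k.succ_pos
    have hm := hmd _ hk
    have hp := hmin _ hk
    rw [hτ _ hk] at hp
    rw [hag _ hk, hhat _ hk]
    rw [hθ _ hk] at hm hp ⊢
    rw [← htsq k]
    exact accelerated_proximal_gradient_step hγ (by linarith [hα.2]) (ht1 k) hfconv hgconv
      (hdiff _) (hsmooth _) hm hp xstar
  intro k hk
  induction k, hk using Nat.le_induction with
  | base => simpa [ht0] using hstep 0
  | succ k _ ih => linarith [hstep k]
end

section
/- (One-iteration inequality of GLALM.) Let X ⊆ ℝⁿ be closed and convex, f : ℝⁿ → ℝ convex differentiable with f(x') ≤ f(x) + ⟨∇f(x), x' − x⟩ + (L/2)‖x' − x‖² for all x, x' (L ≥ 0), g : ℝⁿ → ℝ convex, F = f + g, A an l × n real matrix, b ∈ ℝˡ. Fix θ ∈ (0, 1], γ > 0, κ̃ > 0, and a symmetric positive semidefinite n × n matrix P, and write ‖v‖_P² := ⟨P v, v⟩. Given x_ag, x̂ ∈ ℝⁿ and ẑ ∈ ℝˡ, define x_md = (1 − θ)·x_ag + θ·x̂; let x⁺ be a minimizer over X of x ↦ ⟨∇f(x_md)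 − Aᵀ ẑ, x⟩ + g(x) + (κ̃/2)‖A x − b‖² + (1/2)‖x − x̂‖_P²; set x_ag⁺ = (1 − θ)·x_ag + θ·x⁺ and z⁺ = ẑ − γ·(A x⁺ − b). Then for every x ∈ X with A x = b and every z ∈ ℝˡ: (F(x_ag⁺) − F(x) − ⟨z, A x_ag⁺ − b⟩) − (1 − θ)·(F(x_ag) − F(x) − ⟨z, A x_ag − b⟩) ≤ (θ/2)·(‖x̂ − x‖_P² − ‖x⁺ − x‖_P² − ‖x̂ − x⁺‖_P²) + (L θ²/2)·‖x̂ − x⁺‖² + (θ/(2γ))·(‖ẑ − z‖² − ‖z⁺ − z‖² + ‖ẑ − z⁺‖²) − (θ κ̃/γ²)·‖ẑ − z⁺‖². -/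
open scoped RealInnerProductSpace

section Auxiliary

variable {E F : Type*} [NormedAddCommGroup E] [InnerProductSpace ℝ E]
  [NormedAddCommGroup F] [InnerProductSpace ℝ F]

/-- The gradient inequality for a convex function. -/
lemma ConvexOn.add_inner_gradient_le [CompleteSpace E] {f : E → ℝ} {v x : E}
    (hf : ConvexOn ℝ Set.univ f) (hv : HasGradientAt f v x) (y : E) :
    f x + ⟪v, y - x⟫ ≤ f y := by
  have hline : ConvexOn ℝ Set.univ (f ∘ AffineMap.lineMap (k := ℝ) x y) :=
    hf.comp_affineMap (AffineMap.lineMap x y)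
  have hfd : HasFDerivAt f (InnerProductSpace.toDual ℝ E v)
      (AffineMap.lineMap (k := ℝ) x y 0) := by
    simpa using hv.hasFDerivAt
  have h := hline.le_slope_of_hasDerivAt (Set.mem_univ 0) (Set.mem_univ 1) one_pos
    (hfd.comp_hasDerivAt 0 AffineMap.hasDerivAt_lineMap)
  simp only [slope_def_field, Function.comp_apply, AffineMap.lineMap_apply_zero,
    AffineMap.lineMap_apply_one, InnerProductSpace.toDual_apply_apply, sub_zero, div_one] at h
  linarith

/-- If `t * a + t ^ 2 * c` is nonnegative for all small positive `t`, then so is `a`. -/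
lemma nonneg_of_forall_mul_add_sq_mul_nonneg {a c : ℝ}
    (h : ∀ t ∈ Set.Ioc (0 : ℝ) 1, 0 ≤ t * a + t ^ 2 * c) : 0 ≤ a := by
  by_contra! ha
  have hpos : 0 < |c| - a := by linarith [abs_nonneg c]
  set t : ℝ := -a / (2 * (|c| - a)) with ht
  have htpos : 0 < t := div_pos (neg_pos.2 ha) (by positivity)
  have hta : t * (2 * (|c| - a)) = -a := by rw [ht]; field_simp
  have ht1 : t ≤ 1 := by rw [ht, div_le_one (by positivity)]; linarith [abs_nonneg c]
  have h0 : 0 ≤ a + t * c :=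
    nonneg_of_mul_nonneg_right (by linarith [h t ⟨htpos, ht1⟩]) htpos
  linarith [mul_le_mul_of_nonneg_left (le_abs_self c) htpos.le, mul_neg_of_pos_of_neg htpos ha]

/-- First-order optimality condition for a minimizer of a convex function plus a quadratic. -/
lemma variational_inequality_of_isMinOn {X : Set E} (hX : Convex ℝ X) {g : E → ℝ}
    (hg : ConvexOn ℝ Set.univ g) {T : E →ₗ[ℝ] E} (hT : T.IsSymmetric) (B : E →ₗ[ℝ] F)
    (b : F) (v c : E) (κ : ℝ) {p : E} (hp : p ∈ X)
    (hmin : ∀ x ∈ X,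
      ⟪v, p⟫ + g p + κ / 2 * ‖B p - b‖ ^ 2 + 1 / 2 * ⟪T (p - c), p - c⟫
        ≤ ⟪v, x⟫ + g x + κ / 2 * ‖B x - b‖ ^ 2 + 1 / 2 * ⟪T (x - c), x - c⟫)
    {y : E} (hy : y ∈ X) :
    0 ≤ ⟪v, y - p⟫ + (g y - g p) + κ * ⟪B p - b, B (y - p)⟫ + ⟪T (p - c), y - p⟫ := by
  refine nonneg_of_forall_mul_add_sq_mul_nonneg
    (c := κ / 2 * ‖B (y - p)‖ ^ 2 + 1 / 2 * ⟪T (y - p), y - p⟫) fun t ht ↦ ?_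
  have hcomb : (1 - t) • p + t • y = p + t • (y - p) := by module
  have hmem : p + t • (y - p) ∈ X :=
    hcomb ▸ hX hp hy (sub_nonneg.2 ht.2) ht.1.le (by ring)
  have hgt : g (p + t • (y - p)) ≤ (1 - t) * g p + t * g y := by
    simpa [hcomb] using
      hg.2 (Set.mem_univ p) (Set.mem_univ y) (sub_nonneg.2 ht.2) ht.1.le (by ring)
  have hB : ‖B (p + t • (y - p)) - b‖ ^ 2
      = ‖B p - b‖ ^ 2 + 2 * (t * ⟪B p - b, B (y - p)⟫) + t ^ 2 * ‖B (y - p)‖ ^ 2 := by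
    rw [map_add, map_smul, add_sub_right_comm, norm_add_sq_real, real_inner_smul_right,
      norm_smul, mul_pow, Real.norm_eq_abs, sq_abs]
  have hTt : ⟪T (p + t • (y - p) - c), p + t • (y - p) - c⟫
      = ⟪T (p - c), p - c⟫ + 2 * (t * ⟪T (p - c), y - p⟫) + t ^ 2 * ⟪T (y - p), y - p⟫ := by
    have hsymm : ⟪T (y - p), p - c⟫ = ⟪T (p - c), y - p⟫ := by
      rw [hT, real_inner_comm]
    rw [add_sub_right_comm, map_add, map_smul]
    simp only [inner_add_left, inner_add_right, real_inner_smul_left, real_inner_smul_right,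
      hsymm]
    ring
  have h := hmin _ hmem
  rw [hB, hTt, inner_add_right, real_inner_smul_right] at h
  linarith

/-- The three-point identity for the quadratic form of a symmetric operator. -/
lemma LinearMap.IsSymmetric.three_point {T : E →ₗ[ℝ] E} (hT : T.IsSymmetric) (c p x : E) :
    ⟪T (c - x), c - x⟫ - ⟪T (p - x), p - x⟫ - ⟪T (c - p), c - p⟫
      = 2 * ⟪T (p - c), x - p⟫ := by
  have hcx : c - x = (c - p) + (p - x) := by abel
  have hsymm : ⟪T (p - x), c - p⟫ = ⟪T (c - p), p - x⟫ := by rw [hT, real_inner_comm]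
  rw [hcx, ← neg_sub c p, ← neg_sub p x, map_add, map_neg, inner_neg_neg]
  simp only [inner_add_left, inner_add_right, hsymm]
  ring

/-- The descent estimate of an accelerated step for a smooth convex function. -/
lemma ConvexOn.accelerated_step_le [CompleteSpace E] {f : E → ℝ} {v m : E}
    (hf : ConvexOn ℝ Set.univ f) (hv : HasGradientAt f v m) {L : ℝ}
    (hsmooth : ∀ y, f y ≤ f m + ⟪v, y - m⟫ + L / 2 * ‖y - m‖ ^ 2)
    {θ : ℝ} (hθ : θ ∈ Set.Icc (0 : ℝ) 1) {a c : E} (hm : m = (1 - θ) • a + θ • c) (p x : E) :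
    f ((1 - θ) • a + θ • p)
      ≤ (1 - θ) * f a + θ * f x + θ * ⟪v, p - x⟫ + L * θ ^ 2 / 2 * ‖c - p‖ ^ 2 := by
  have hs := hsmooth ((1 - θ) • a + θ • p)
  have hstep : (1 - θ) • a + θ • p - m = θ • (p - c) := by rw [hm]; module
  have hnorm : ‖(1 - θ) • a + θ • p - m‖ ^ 2 = θ ^ 2 * ‖c - p‖ ^ 2 := by
    rw [hstep, norm_smul, mul_pow, Real.norm_eq_abs, sq_abs, norm_sub_rev]
  have hsplit : (1 - θ) • a + θ • p - m
      = (1 - θ) • (a - m) + θ • (x - m) + θ • (p - x) := by module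
  rw [hnorm, hsplit, inner_add_right, inner_add_right, real_inner_smul_right,
    real_inner_smul_right, real_inner_smul_right] at hs
  have ha := mul_le_mul_of_nonneg_left (hf.add_inner_gradient_le hv a) (sub_nonneg.2 hθ.2)
  have hx := mul_le_mul_of_nonneg_left (hf.add_inner_gradient_le hv x) hθ.1
  linarith

end Auxiliary

theorem glalm_one_iteration {n l : ℕ}
    (X : Set (EuclideanSpace ℝ (Fin n))) (hXcl : IsClosed X) (hXcv : Convex ℝ X)
    (f g : EuclideanSpace ℝ (Fin n) → ℝ)
    (f' : EuclideanSpace ℝ (Fin n) → EuclideanSpace ℝ (Fin n))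
    (L : ℝ) (hL : 0 ≤ L)
    (hdiff : ∀ x, HasGradientAt f (f' x) x)
    (hfconv : ConvexOn ℝ Set.univ f)
    (hgconv : ConvexOn ℝ Set.univ g)
    (hsmooth : ∀ x x', f x' ≤ f x + ⟪f' x, x' - x⟫ + L / 2 * ‖x' - x‖ ^ 2)
    (A : Matrix (Fin l) (Fin n) ℝ) (b : EuclideanSpace ℝ (Fin l))
    (θ γ κt : ℝ) (hθ : θ ∈ Set.Ioc (0 : ℝ) 1) (hγ : 0 < γ) (hκt : 0 < κt)
    (P : Matrix (Fin n) (Fin n) ℝ) (hPsymm : P.IsSymm) (hPpsd : P.PosSemidef)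
    (xag xhat xmd xplus xagp : EuclideanSpace ℝ (Fin n))
    (zhat zplus : EuclideanSpace ℝ (Fin l))
    (hmd : xmd = (1 - θ) • xag + θ • xhat)
    (hplusX : xplus ∈ X)
    (hplusmin : ∀ x ∈ X,
      ⟪f' xmd - Matrix.toEuclideanLin A.transpose zhat, xplus⟫ + g xplus
          + κt / 2 * ‖Matrix.toEuclideanLin A xplus - b‖ ^ 2
          + 1 / 2 * ⟪Matrix.toEuclideanLin P (xplus - xhat), xplus - xhat⟫
        ≤ ⟪f' xmd - Matrix.toEuclideanLin A.transpose zhat, x⟫ + g x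
          + κt / 2 * ‖Matrix.toEuclideanLin A x - b‖ ^ 2
          + 1 / 2 * ⟪Matrix.toEuclideanLin P (x - xhat), x - xhat⟫)
    (hagp : xagp = (1 - θ) • xag + θ • xplus)
    (hz : zplus = zhat - γ • (Matrix.toEuclideanLin A xplus - b)) :
    ∀ x ∈ X, Matrix.toEuclideanLin A x = b →
      ∀ z : EuclideanSpace ℝ (Fin l),
        ((f xagp + g xagp) - (f x + g x) - ⟪z, Matrix.toEuclideanLin A xagp - b⟫)
            - (1 - θ) * ((f xag + g xag) - (f x + g x)
                - ⟪z, Matrix.toEuclideanLin A xag - b⟫)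
          ≤ θ / 2 * (⟪Matrix.toEuclideanLin P (xhat - x), xhat - x⟫
                - ⟪Matrix.toEuclideanLin P (xplus - x), xplus - x⟫
                - ⟪Matrix.toEuclideanLin P (xhat - xplus), xhat - xplus⟫)
            + L * θ ^ 2 / 2 * ‖xhat - xplus‖ ^ 2
            + θ / (2 * γ) * (‖zhat - z‖ ^ 2 - ‖zplus - z‖ ^ 2 + ‖zhat - zplus‖ ^ 2)
            - θ * κt / γ ^ 2 * ‖zhat - zplus‖ ^ 2 := by
  intro x hx hAx z
  have hθ' : θ ∈ Set.Icc (0 : ℝ) 1 := Set.Ioc_subset_Icc_self hθ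
  have hT : (Matrix.toEuclideanLin P).IsSymmetric :=
    Matrix.isSymmetric_toEuclideanLin_iff.2 hPpsd.isHermitian
  have hvar := variational_inequality_of_isMinOn hXcv hgconv hT (Matrix.toEuclideanLin A) b
    (f' xmd - Matrix.toEuclideanLin A.transpose zhat) xhat κt hplusX hplusmin hx
  have hf := hfconv.accelerated_step_le (hdiff xmd) (hsmooth xmd) hθ' hmd xplus x
  have hg : g ((1 - θ) • xag + θ • xplus) ≤ (1 - θ) * g xag + θ * g xplus := by
    simpa using hgconv.2 (Set.mem_univ xag) (Set.mem_univ xplus)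
      (sub_nonneg.2 hθ'.2) hθ'.1 (by ring)
  rw [← hagp] at hf hg
  have hadj : ⟪Matrix.toEuclideanLin A.transpose zhat, x - xplus⟫
      = ⟪zhat, Matrix.toEuclideanLin A (x - xplus)⟫ := by
    rw [← A.conjTranspose_eq_transpose_of_trivial,
      Matrix.toEuclideanLin_conjTranspose_eq_adjoint, LinearMap.adjoint_inner_left]
  set r := Matrix.toEuclideanLin A xplus - b with hr
  have hAd : Matrix.toEuclideanLin A (x - xplus) = -r := by rw [map_sub, hAx, hr, neg_sub]
  rw [inner_sub_left, hadj, hAd, inner_neg_right, inner_neg_right,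
    real_inner_self_eq_norm_sq, ← neg_sub xplus x, inner_neg_right, neg_sub] at hvar
  have hres : Matrix.toEuclideanLin A xagp - b
      = (1 - θ) • (Matrix.toEuclideanLin A xag - b) + θ • r := by
    rw [hagp, map_add, map_smul, map_smul, hr]; module
  have hzd : zhat - zplus = γ • r := by rw [hz, sub_sub_cancel]
  have hzn : ‖zhat - zplus‖ ^ 2 = γ ^ 2 * ‖r‖ ^ 2 := by
    rw [hzd, norm_smul, mul_pow, Real.norm_eq_abs, sq_abs]
  have hzp : ‖zplus - z‖ ^ 2 = ‖zhat - z‖ ^ 2 - 2 * (γ * ⟪zhat - z, r⟫) + γ ^ 2 * ‖r‖ ^ 2 := by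
    rw [hz, sub_right_comm, norm_sub_sq_real, real_inner_smul_right, norm_smul, mul_pow,
      Real.norm_eq_abs, sq_abs]
  have hdual : θ / (2 * γ) * (‖zhat - z‖ ^ 2 - ‖zplus - z‖ ^ 2 + ‖zhat - zplus‖ ^ 2)
      = θ * (⟪zhat, r⟫ - ⟪z, r⟫) := by
    rw [hzp, hzn, inner_sub_left]; field_simp; ring
  have hpen : θ * κt / γ ^ 2 * ‖zhat - zplus‖ ^ 2 = θ * (κt * ‖r‖ ^ 2) := by
    rw [hzn]; field_simp
  rw [hdual, hpen, hT.three_point, hres, inner_add_right, real_inner_smul_right,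
    real_inner_smul_right]
  have hvarθ := mul_nonneg hθ'.1 hvar
  linarith
end
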